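/- Let X be a real random variable with finite variance, t > 0, and Y = X + √t·Z with Z ~ N(0,1) independent of X. Then the differential entropy H(Y) = −E[log f_Y(Y)] is differentiable in t and d/dt H(X + √t·Z) = ( −E[X²] + E[(E[X|Y])²] ) / (2t²) + 1/(2t). -/

import Mathlib

open MeasureTheory ProbabilityTheory Real

/-- The density of `X + √t·Z` (Gaussian smoothing of the law `μ` of `X` at time `t`):
`f_t(y) = ∫ (2πt)^{-1/2} · exp(-(y-x)²/(2t)) dμ(x)`. -/
noncomputable def heatDensity (μ : Measure ℝ) (t : ℝ) (y : ℝ) : ℝ :=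
  ∫ x, (Real.sqrt (2 * Real.pi * t))⁻¹ * Real.exp (-(y - x) ^ 2 / (2 * t)) ∂μ

/-- The differential entropy `H(X + √t·Z) = -∫ f_t(y) log f_t(y) dy` of the Gaussian
smoothing at time `t` of the law `μ` of `X`. -/
noncomputable def smoothedEntropy (μ : Measure ℝ) (t : ℝ) : ℝ :=
  -∫ y, heatDensity μ t y * Real.log (heatDensity μ t y)

/-- The centred Gaussian density of variance `s`. -/
noncomputable def gaussKernel (s u : ℝ) : ℝ :=
  (√(2 * π * s))⁻¹ * exp (-u ^ 2 / (2 * s))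

/-- First derivative of `gaussKernel s`. -/
noncomputable def gaussKernelDeriv (s u : ℝ) : ℝ := -(u / s) * gaussKernel s u

/-- Second derivative of `gaussKernel s`. -/
noncomputable def gaussKernelDeriv₂ (s u : ℝ) : ℝ := (u ^ 2 / s ^ 2 - 1 / s) * gaussKernel s u

/-- The convolution `∫ φ(y - x) dμ(x)`. -/
noncomputable def smear (μ : Measure ℝ) (φ : ℝ → ℝ) (y : ℝ) : ℝ := ∫ x, φ (y - x) ∂μ

lemma heatDensity_eq_smear (μ : Measure ℝ) (s : ℝ) :
    heatDensity μ s = smear μ (gaussKernel s) := rfl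

lemma gaussKernel_pos {s : ℝ} (hs : 0 < s) (u : ℝ) : 0 < gaussKernel s u := by
  unfold gaussKernel
  positivity

lemma hasDerivAt_gaussKernel (s u : ℝ) :
    HasDerivAt (gaussKernel s) (gaussKernelDeriv s u) u := by
  have h : HasDerivAt (fun u : ℝ ↦ -u ^ 2 / (2 * s)) (-(u / s)) u := by
    refine (((hasDerivAt_id u).pow 2).neg.div_const (2 * s)).congr_deriv ?_
    simp only [id]
    rw [show (-(u / s)) = -(2 * u) / (2 * s) by rw [neg_div, mul_div_mul_left _ _ two_ne_zero]]
    norm_num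
  refine (h.exp.const_mul (√(2 * π * s))⁻¹).congr_deriv ?_
  unfold gaussKernelDeriv gaussKernel
  ring

lemma hasDerivAt_gaussKernelDeriv (s u : ℝ) :
    HasDerivAt (gaussKernelDeriv s) (gaussKernelDeriv₂ s u) u := by
  refine (((hasDerivAt_id u).div_const s).neg.mul (hasDerivAt_gaussKernel s u)).congr_deriv ?_
  unfold gaussKernelDeriv₂ gaussKernelDeriv
  simp only [id, Pi.neg_apply]
  ring

/-- The Gaussian kernel solves the heat equation. -/
lemma hasDerivAt_gaussKernel_time {s : ℝ} (hs : 0 < s) (u : ℝ) :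
    HasDerivAt (fun r ↦ gaussKernel r u) (gaussKernelDeriv₂ s u / 2) s := by
  have hpos : 0 < 2 * π * s := by positivity
  have h1 : HasDerivAt (fun r : ℝ ↦ (√(2 * π * r))⁻¹)
      (-(1 / (2 * s)) * (√(2 * π * s))⁻¹) s := by
    have := (((hasDerivAt_id s).const_mul (2 * π)).sqrt hpos.ne').inv (Real.sqrt_pos.2 hpos).ne'
    refine this.congr_deriv ?_
    have h := Real.sq_sqrt hpos.le
    simp only [id]
    rw [h]
    have := (Real.sqrt_pos.2 hpos).ne'
    field_simp
  have h2 : HasDerivAt (fun r : ℝ ↦ -u ^ 2 / (2 * r)) (u ^ 2 / (2 * s ^ 2)) s := by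
    refine ((hasDerivAt_const s (-u ^ 2)).div ((hasDerivAt_id s).const_mul 2)
      (by simpa using hs.ne')).congr_deriv ?_
    simp only [id]
    field_simp
    ring
  refine (h1.mul h2.exp).congr_deriv ?_
  unfold gaussKernelDeriv₂ gaussKernel
  ring

lemma continuous_gaussKernel (s : ℝ) : Continuous (gaussKernel s) :=
  continuous_iff_continuousAt.2 fun u ↦ (hasDerivAt_gaussKernel s u).continuousAt

lemma continuous_gaussKernelDeriv (s : ℝ) : Continuous (gaussKernelDeriv s) :=
  continuous_iff_continuousAt.2 fun u ↦ (hasDerivAt_gaussKernelDeriv s u).continuousAt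

lemma continuous_gaussKernelDeriv₂ (s : ℝ) : Continuous (gaussKernelDeriv₂ s) := by
  have := continuous_gaussKernel s
  unfold gaussKernelDeriv₂
  fun_prop

/-- The kernel and its derivatives are dominated by one Gaussian, uniformly for times in
`[a, b]`. -/
lemma exists_gaussKernel_bound {a b : ℝ} (ha : 0 < a) :
    ∃ C, 0 ≤ C ∧ ∀ s ∈ Set.Icc a b, ∀ u,
      |gaussKernel s u| ≤ C * exp (-(1 / (4 * b)) * u ^ 2) ∧
      |gaussKernelDeriv s u| ≤ C * exp (-(1 / (4 * b)) * u ^ 2) ∧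
      |gaussKernelDeriv₂ s u| ≤ C * exp (-(1 / (4 * b)) * u ^ 2) := by
  by_cases hab : a ≤ b
  swap
  · exact ⟨0, le_rfl, fun s hs ↦ absurd (hs.1.trans hs.2) hab⟩
  have hb : 0 < b := ha.trans_le hab
  set D : ℝ := 1 + 1 / a + 1 / a ^ 2
  refine ⟨D * ((√(2 * π * a))⁻¹ * (1 + 4 * b)), by positivity, fun s hs u ↦ ?_⟩
  have hs0 : 0 < s := ha.trans_le hs.1
  have key : (1 + u ^ 2) * gaussKernel s u
      ≤ (√(2 * π * a))⁻¹ * (1 + 4 * b) * exp (-(1 / (4 * b)) * u ^ 2) := by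
    have h1 : (√(2 * π * s))⁻¹ ≤ (√(2 * π * a))⁻¹ := by
      have := hs.1
      gcongr
    have h2 : exp (-u ^ 2 / (2 * s))
        ≤ exp (-(1 / (4 * b)) * u ^ 2) * exp (-(1 / (4 * b)) * u ^ 2) := by
      rw [← exp_add, exp_le_exp]
      have : u ^ 2 / (2 * b) ≤ u ^ 2 / (2 * s) := by
        have := hs.2
        gcongr
      have e : -(1 / (4 * b)) * u ^ 2 + -(1 / (4 * b)) * u ^ 2 = -(u ^ 2 / (2 * b)) := by
        field_simp; ring
      rw [e, neg_div]
      linarith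
    have h3 : (1 + u ^ 2) * exp (-(1 / (4 * b)) * u ^ 2) ≤ 1 + 4 * b := by
      have h4 : exp (-(1 / (4 * b)) * u ^ 2) ≤ 1 := by
        rw [exp_le_one_iff]
        have : 0 ≤ 1 / (4 * b) * u ^ 2 := by positivity
        linarith
      have h5 : 1 / (4 * b) * u ^ 2 * exp (-(1 / (4 * b)) * u ^ 2) ≤ 1 := by
        rw [neg_mul, exp_neg, mul_inv_le_iff₀ (exp_pos _), one_mul]
        linarith [add_one_le_exp (1 / (4 * b) * u ^ 2)]
      have h6 : u ^ 2 * exp (-(1 / (4 * b)) * u ^ 2)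
          = 4 * b * (1 / (4 * b) * u ^ 2 * exp (-(1 / (4 * b)) * u ^ 2)) := by
        field_simp
      rw [add_mul, h6, one_mul]
      exact add_le_add h4 (mul_le_of_le_one_right (by positivity) h5)
    calc (1 + u ^ 2) * gaussKernel s u
        ≤ (1 + u ^ 2) * ((√(2 * π * a))⁻¹ *
          (exp (-(1 / (4 * b)) * u ^ 2) * exp (-(1 / (4 * b)) * u ^ 2))) := by
          unfold gaussKernel
          gcongr
      _ = (√(2 * π * a))⁻¹ * ((1 + u ^ 2) * exp (-(1 / (4 * b)) * u ^ 2))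
          * exp (-(1 / (4 * b)) * u ^ 2) := by ring
      _ ≤ _ := by gcongr
  have step : ∀ p : ℝ, |p| ≤ D * (1 + u ^ 2) → |p * gaussKernel s u| ≤
      D * ((√(2 * π * a))⁻¹ * (1 + 4 * b)) * exp (-(1 / (4 * b)) * u ^ 2) := fun p hp ↦ by
    have hK := gaussKernel_pos hs0 u
    rw [abs_mul, abs_of_pos hK]
    calc |p| * gaussKernel s u ≤ D * (1 + u ^ 2) * gaussKernel s u := by gcongr
      _ = D * ((1 + u ^ 2) * gaussKernel s u) := by ring
      _ ≤ D * ((√(2 * π * a))⁻¹ * (1 + 4 * b) * exp (-(1 / (4 * b)) * u ^ 2)) := by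
        have : 0 ≤ D := by positivity
        gcongr
      _ = _ := by ring
  have i1 : 1 / s ≤ 1 / a := one_div_le_one_div_of_le ha hs.1
  have i2 : 1 / s ^ 2 ≤ 1 / a ^ 2 :=
    one_div_le_one_div_of_le (by positivity) (by have := hs.1; gcongr)
  have j1 : 0 < 1 / s := by positivity
  have j2 : 0 < 1 / s ^ 2 := by positivity
  have hu : |u| ≤ 1 + u ^ 2 := by
    rw [← sq_abs]
    nlinarith [sq_nonneg (|u| - 1), abs_nonneg u]
  refine ⟨?_, step _ ?_, step _ ?_⟩
  · rw [← one_mul (gaussKernel s u)]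
    refine step 1 ?_
    rw [abs_one]
    nlinarith [sq_nonneg u]
  · rw [abs_neg, abs_div, abs_of_pos hs0, div_eq_mul_one_div]
    calc |u| * (1 / s) ≤ (1 + u ^ 2) * D := by
          refine mul_le_mul hu ?_ j1.le (by positivity)
          linarith
      _ = _ := mul_comm _ _
  · rw [abs_le, div_eq_mul_one_div]
    constructor <;> nlinarith [sq_nonneg u, mul_nonneg (sq_nonneg u) j2.le,
      mul_nonneg (sq_nonneg u) (sub_nonneg.2 i2), mul_nonneg (sq_nonneg u) (sub_nonneg.2 i1),
      mul_nonneg (sq_nonneg u) j1.le]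

section Smear

variable {μ : Measure ℝ} [IsProbabilityMeasure μ] {φ φ' : ℝ → ℝ} {C D c : ℝ}

lemma abs_le_of_gaussian_bound (hC : 0 ≤ C) (hc : 0 < c)
    (h : ∀ u, |φ u| ≤ C * exp (-c * u ^ 2)) (u : ℝ) : |φ u| ≤ C := by
  refine (h u).trans (mul_le_of_le_one_right hC ?_)
  rw [exp_le_one_iff]
  nlinarith [sq_nonneg u]

lemma integrable_comp_sub (hφ : Continuous φ) (h : ∀ u, |φ u| ≤ C) (y : ℝ) :
    Integrable (fun x ↦ φ (y - x)) μ :=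
  Integrable.of_bound (by fun_prop) C (ae_of_all _ fun x ↦ h (y - x))

lemma continuous_smear (hφ : Continuous φ) (h : ∀ u, |φ u| ≤ C) : Continuous (smear μ φ) :=
  continuous_of_dominated (fun y ↦ by fun_prop) (fun y ↦ ae_of_all _ fun x ↦ h (y - x))
    (integrable_const C) (ae_of_all _ fun x ↦ by fun_prop)

lemma hasDerivAt_smear (hφ : ∀ u, HasDerivAt φ (φ' u) u) (hφ' : Continuous φ')
    (h : ∀ u, |φ u| ≤ C) (h' : ∀ u, |φ' u| ≤ D) (y : ℝ) :
    HasDerivAt (smear μ φ) (smear μ φ' y) y := by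
  have hc : Continuous φ := continuous_iff_continuousAt.2 fun u ↦ (hφ u).continuousAt
  refine (hasDerivAt_integral_of_dominated_loc_of_deriv_le (F := fun y x ↦ φ (y - x))
    (F' := fun y x ↦ φ' (y - x)) (bound := fun _ ↦ D)
    Filter.univ_mem (Filter.Eventually.of_forall fun y ↦ by fun_prop) (integrable_comp_sub hc h y)
    (by fun_prop) (ae_of_all _ fun x z _ ↦ h' (z - x)) (integrable_const _)
    (ae_of_all _ fun x z _ ↦ (hφ (z - x)).comp_sub_const z x)).2

lemma abs_smear_le (h : ∀ u, |φ u| ≤ C * exp (-c * u ^ 2)) (hc : 0 < c) (y : ℝ) :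
    |smear μ φ y| ≤ C * smear μ (fun u ↦ exp (-c * u ^ 2)) y := by
  unfold smear
  rw [← integral_const_mul]
  refine norm_integral_le_of_norm_le (f := fun x ↦ φ (y - x))
    (g := fun x ↦ C * exp (-c * (y - x) ^ 2))
    (Integrable.const_mul ?_ C) (ae_of_all _ fun x ↦ h (y - x))
  refine integrable_comp_sub (C := 1) (φ := fun u ↦ exp (-c * u ^ 2)) (by fun_prop) (fun u ↦ ?_) y
  rw [abs_of_pos (exp_pos _), exp_le_one_iff]
  nlinarith [sq_nonneg u]

lemma integrable_sq_mul_exp_neg_mul_sq (hc : 0 < c) :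
    Integrable (fun u : ℝ ↦ u ^ 2 * exp (-c * u ^ 2)) := by
  simpa using integrable_rpow_mul_exp_neg_mul_sq hc (s := 2) (by norm_num)

/-- If `μ` has a second moment, then so does its convolution with a Gaussian. -/
lemma integrable_weight_mul_smear (hμ : Integrable (fun x ↦ x ^ 2) μ) (hc : 0 < c) :
    Integrable (fun y ↦ (1 + y ^ 2) * smear μ (fun u ↦ exp (-c * u ^ 2)) y) := by
  have h1 : Integrable (fun p : ℝ × ℝ ↦ (1 + (p.1 + p.2) ^ 2) * exp (-c * p.2 ^ 2))
      (μ.prod volume) := by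
    have g1 := (((integrable_const (1 : ℝ)).add (hμ.const_mul 2))).mul_prod
      (integrable_exp_neg_mul_sq hc)
    have g2 := (integrable_const (μ := μ) (2 : ℝ)).mul_prod (integrable_sq_mul_exp_neg_mul_sq hc)
    refine (g1.add g2).mono (by fun_prop) (ae_of_all _ fun p ↦ ?_)
    have he := exp_pos (-c * p.2 ^ 2)
    simp only [Pi.add_apply, Real.norm_eq_abs]
    rw [abs_of_nonneg (by positivity), abs_of_nonneg (by positivity)]
    nlinarith [mul_nonneg (sq_nonneg (p.1 - p.2)) he.le]
  have h2 : Integrable (fun p : ℝ × ℝ ↦ (1 + p.2 ^ 2) * exp (-c * (p.2 - p.1) ^ 2))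
      (μ.prod volume) := by
    have hm := measurePreserving_prod_add μ (volume : Measure ℝ)
    rw [← hm.integrable_comp_emb (MeasurableEquiv.shearAddRight ℝ).measurableEmbedding]
    simpa [Function.comp_def] using h1
  have h3 := h2.integral_prod_right
  simpa only [smear, integral_const_mul] using h3

end Smear

section HeatFlow

variable {μ : Measure ℝ} [IsProbabilityMeasure μ] {a b t : ℝ}

lemma exists_gaussKernel_const_bound (ht : 0 < t) :
    ∃ C, 0 ≤ C ∧ ∀ u, |gaussKernel t u| ≤ C ∧ |gaussKernelDeriv t u| ≤ C ∧
      |gaussKernelDeriv₂ t u| ≤ C := by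
  obtain ⟨C, hC, h⟩ := exists_gaussKernel_bound (b := t) ht
  have hc : 0 < 1 / (4 * t) := by positivity
  have ht' : t ∈ Set.Icc t t := ⟨le_rfl, le_rfl⟩
  exact ⟨C, hC, fun u ↦ ⟨abs_le_of_gaussian_bound hC hc (fun u ↦ (h t ht' u).1) u,
    abs_le_of_gaussian_bound hC hc (fun u ↦ (h t ht' u).2.1) u,
    abs_le_of_gaussian_bound hC hc (fun u ↦ (h t ht' u).2.2) u⟩⟩

lemma integrable_gaussKernel_comp_sub (ht : 0 < t) (y : ℝ) :
    Integrable (fun x ↦ gaussKernel t (y - x)) μ := by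
  obtain ⟨C, -, h⟩ := exists_gaussKernel_const_bound ht
  exact integrable_comp_sub (continuous_gaussKernel t) (fun u ↦ (h u).1) y

lemma heatDensity_pos (ht : 0 < t) (y : ℝ) : 0 < heatDensity μ t y := by
  rw [heatDensity_eq_smear, smear]
  refine (integral_pos_iff_support_of_nonneg (fun x ↦ (gaussKernel_pos ht _).le)
    (integrable_gaussKernel_comp_sub ht y)).2 ?_
  have : Function.support (fun x ↦ gaussKernel t (y - x)) = Set.univ :=
    Set.eq_univ_of_forall fun x ↦ (gaussKernel_pos ht _).ne'
  rw [this, measure_univ]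
  exact one_pos

lemma hasDerivAt_heatDensity (ht : 0 < t) (y : ℝ) :
    HasDerivAt (heatDensity μ t) (smear μ (gaussKernelDeriv t) y) y := by
  obtain ⟨C, -, h⟩ := exists_gaussKernel_const_bound ht
  exact hasDerivAt_smear (hasDerivAt_gaussKernel t) (continuous_gaussKernelDeriv t)
    (fun u ↦ (h u).1) (fun u ↦ (h u).2.1) y

lemma hasDerivAt_smear_gaussKernelDeriv (ht : 0 < t) (y : ℝ) :
    HasDerivAt (smear μ (gaussKernelDeriv t)) (smear μ (gaussKernelDeriv₂ t) y) y := by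
  obtain ⟨C, -, h⟩ := exists_gaussKernel_const_bound ht
  exact hasDerivAt_smear (hasDerivAt_gaussKernelDeriv t) (continuous_gaussKernelDeriv₂ t)
    (fun u ↦ (h u).2.1) (fun u ↦ (h u).2.2) y

lemma continuous_heatDensity (ht : 0 < t) : Continuous (heatDensity μ t) :=
  continuous_iff_continuousAt.2 fun y ↦ (hasDerivAt_heatDensity ht y).continuousAt

lemma continuous_smear_gaussKernelDeriv (ht : 0 < t) :
    Continuous (smear μ (gaussKernelDeriv t)) :=
  continuous_iff_continuousAt.2 fun y ↦ (hasDerivAt_smear_gaussKernelDeriv ht y).continuousAt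

lemma continuous_smear_gaussKernelDeriv₂ (ht : 0 < t) :
    Continuous (smear μ (gaussKernelDeriv₂ t)) := by
  obtain ⟨C, -, h⟩ := exists_gaussKernel_const_bound ht
  exact continuous_smear (continuous_gaussKernelDeriv₂ t) fun u ↦ (h u).2.2

lemma continuous_log_heatDensity (ht : 0 < t) : Continuous fun y ↦ log (heatDensity μ t y) :=
  (continuous_heatDensity ht).log fun y ↦ (heatDensity_pos ht y).ne'

/-- The heat equation for `heatDensity`. -/
lemma hasDerivAt_heatDensity_time (ht : 0 < t) (y : ℝ) :
    HasDerivAt (fun s ↦ heatDensity μ s y) (smear μ (gaussKernelDeriv₂ t) y / 2) t := by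
  obtain ⟨C, hC, h⟩ := exists_gaussKernel_bound (a := t / 2) (b := 2 * t) (by positivity)
  have hc : 0 < 1 / (4 * (2 * t)) := by positivity
  have hs : Set.Icc (t / 2) (2 * t) ∈ nhds t := Icc_mem_nhds (by linarith) (by linarith)
  have := (hasDerivAt_integral_of_dominated_loc_of_deriv_le (μ := μ)
    (F := fun s x ↦ gaussKernel s (y - x)) (F' := fun s x ↦ gaussKernelDeriv₂ s (y - x) / 2)
    (bound := fun _ ↦ C / 2) hs
    (Filter.Eventually.of_forall fun s ↦
      ((continuous_gaussKernel s).comp (continuous_sub_left y)).aestronglyMeasurable)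
    (integrable_gaussKernel_comp_sub ht y)
    (((continuous_gaussKernelDeriv₂ t).comp
      (continuous_sub_left y)).div_const 2).aestronglyMeasurable
    (ae_of_all _ fun x s hs ↦ ?_) (integrable_const _)
    (ae_of_all _ fun x s hs ↦ hasDerivAt_gaussKernel_time (by linarith [hs.1]) _)).2
  · rwa [integral_div] at this
  · rw [Real.norm_eq_abs, abs_div, abs_two]
    gcongr
    exact abs_le_of_gaussian_bound hC hc (fun u ↦ (h s hs u).2.2) _

/-- The logarithm of the density grows at most quadratically, uniformly for times in `[a, b]`. -/
lemma exists_abs_log_heatDensity_le (ha : 0 < a) :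
    ∃ L, 0 ≤ L ∧ ∀ s ∈ Set.Icc a b, ∀ y, |log (heatDensity μ s y)| ≤ L * (1 + y ^ 2) := by
  by_cases hab : a ≤ b
  swap
  · exact ⟨0, le_rfl, fun s hs ↦ absurd (hs.1.trans hs.2) hab⟩
  have hb : 0 < b := ha.trans_le hab
  obtain ⟨C, hC, h⟩ := exists_gaussKernel_bound (a := a) (b := b) ha
  have hc : 0 < 1 / (4 * b) := by positivity
  have hint : Integrable (fun x ↦ exp (-(x ^ 2 / a))) μ :=
    Integrable.of_bound (by fun_prop) 1 (ae_of_all _ fun x ↦ by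
      rw [Real.norm_eq_abs, abs_of_pos (exp_pos _), exp_le_one_iff, neg_nonpos]
      positivity)
  set c₀ : ℝ := (√(2 * π * b))⁻¹ * ∫ x, exp (-(x ^ 2 / a)) ∂μ
  have hc₀ : 0 < c₀ := mul_pos (by positivity) (integral_exp_pos hint)
  refine ⟨C + |log c₀| + 1 / a, by positivity, fun s hs y ↦ ?_⟩
  have hs0 : 0 < s := ha.trans_le hs.1
  have hpos := heatDensity_pos (μ := μ) hs0 y
  have upper : heatDensity μ s y ≤ C := by
    calc heatDensity μ s y ≤ ∫ _, C ∂μ :=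
          integral_mono (integrable_gaussKernel_comp_sub hs0 y) (integrable_const C)
            fun x ↦ (le_abs_self _).trans
              (abs_le_of_gaussian_bound hC hc (fun u ↦ (h s hs u).1) _)
      _ = C := by simp
  have lower : c₀ * exp (-(y ^ 2 / a)) ≤ heatDensity μ s y := by
    have : c₀ * exp (-(y ^ 2 / a))
        = ∫ x, (√(2 * π * b))⁻¹ * (exp (-(x ^ 2 / a)) * exp (-(y ^ 2 / a))) ∂μ := by
      rw [integral_const_mul, integral_mul_const, mul_assoc]
    rw [this]
    refine integral_mono ((hint.mul_const _).const_mul _)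
      (integrable_gaussKernel_comp_sub hs0 y) fun x ↦ ?_
    have h1 : (√(2 * π * b))⁻¹ ≤ (√(2 * π * s))⁻¹ := by
      have := hs.2
      gcongr
    have h2 : (y - x) ^ 2 / (2 * s) ≤ x ^ 2 / a + y ^ 2 / a := by
      rw [← add_div, div_le_div_iff₀ (by positivity) ha]
      calc (y - x) ^ 2 * a ≤ (2 * (x ^ 2 + y ^ 2)) * s := by
            refine mul_le_mul ?_ hs.1 ha.le (by positivity)
            nlinarith [sq_nonneg (x + y)]
        _ = _ := by ring
    beta_reduce
    rw [← exp_add]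
    gcongr
    rw [neg_div]
    linarith
  have hlow := log_le_log (by positivity) lower
  rw [log_mul hc₀.ne' (exp_pos _).ne', log_exp] at hlow
  have hup : log (heatDensity μ s y) ≤ C := (log_le_self hpos.le).trans upper
  have hy : 1 / a * y ^ 2 = y ^ 2 / a := by ring
  have q1 : 0 ≤ (C + |log c₀|) * y ^ 2 := by positivity
  have q2 : 0 ≤ y ^ 2 / a := by positivity
  have q3 : 0 < 1 / a := by positivity
  have q4 := neg_abs_le (log c₀)
  have q5 := abs_nonneg (log c₀)
  rw [abs_le]
  constructor <;> nlinarith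

lemma abs_log_add_one_le {L y r : ℝ} (h : |r| ≤ L * (1 + y ^ 2)) :
    |r + 1| ≤ (L + 1) * (1 + y ^ 2) := by
  have := abs_add_le r 1
  rw [abs_one] at this
  nlinarith [sq_nonneg y]

/-- Products of a function of quadratic growth and a function dominated by a smeared Gaussian are
integrable. -/
lemma integrable_mul_of_quadratic_growth (hμ : Integrable (fun x ↦ x ^ 2) μ)
    {φ ψ : ℝ → ℝ} {C L c : ℝ} (hc : 0 < c) (hL : 0 ≤ L) (hφ : Continuous φ) (hψ : Continuous ψ)
    (h : ∀ y, |φ y| ≤ C * smear μ (fun u ↦ exp (-c * u ^ 2)) y)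
    (h' : ∀ y, |ψ y| ≤ L * (1 + y ^ 2)) : Integrable (ψ * φ) := by
  refine ((integrable_weight_mul_smear hμ hc).const_mul (L * C)).mono'
    (hψ.mul hφ).aestronglyMeasurable (ae_of_all _ fun y ↦ ?_)
  rw [Pi.mul_apply, norm_mul]
  calc |ψ y| * |φ y| ≤ L * (1 + y ^ 2) * (C * smear μ (fun u ↦ exp (-c * u ^ 2)) y) :=
        mul_le_mul (h' y) (h y) (abs_nonneg _) (by positivity)
    _ = _ := by ring

lemma hasDerivAt_smoothedEntropy (hμ : Integrable (fun x ↦ x ^ 2) μ) (ht : 0 < t) :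
    HasDerivAt (smoothedEntropy μ)
      (-∫ y, smear μ (gaussKernelDeriv₂ t) y / 2 * (log (heatDensity μ t y) + 1)) t := by
  obtain ⟨C, hC, h⟩ := exists_gaussKernel_bound (a := t / 2) (b := 2 * t) (by positivity)
  obtain ⟨L, hL, hlog⟩ :=
    exists_abs_log_heatDensity_le (μ := μ) (a := t / 2) (b := 2 * t) (by positivity)
  have hc : 0 < 1 / (4 * (2 * t)) := by positivity
  have hts : t ∈ Set.Icc (t / 2) (2 * t) := ⟨by linarith, by linarith⟩
  have hs : Set.Icc (t / 2) (2 * t) ∈ nhds t := Icc_mem_nhds (by linarith) (by linarith)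
  refine (hasDerivAt_integral_of_dominated_loc_of_deriv_le
    (F := fun s y ↦ heatDensity μ s y * log (heatDensity μ s y))
    (F' := fun s y ↦ smear μ (gaussKernelDeriv₂ s) y / 2 * (log (heatDensity μ s y) + 1))
    (bound := fun y ↦ C * (L + 1) * ((1 + y ^ 2) *
      smear μ (fun u ↦ exp (-(1 / (4 * (2 * t))) * u ^ 2)) y)) hs
    ?_ ?_ ?_ (ae_of_all _ fun y s hs ↦ ?_) ((integrable_weight_mul_smear hμ hc).const_mul _)
    (ae_of_all _ fun y s hs ↦ ?_)).2.neg
  · filter_upwards [lt_mem_nhds ht] with s hs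
    exact ((continuous_heatDensity hs).mul (continuous_log_heatDensity hs)).aestronglyMeasurable
  · exact (integrable_mul_of_quadratic_growth hμ hc hL (continuous_heatDensity ht)
      (continuous_log_heatDensity ht) (abs_smear_le (fun u ↦ (h t hts u).1) hc)
      (hlog t hts)).congr (ae_of_all _ fun y ↦ mul_comm _ _)
  · exact (((continuous_smear_gaussKernelDeriv₂ ht).div_const 2).mul
      ((continuous_log_heatDensity ht).add continuous_const)).aestronglyMeasurable
  · have h1 := abs_smear_le (μ := μ) (fun u ↦ (h s hs u).2.2) hc y
    have h2 : |smear μ (gaussKernelDeriv₂ s) y / 2|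
        ≤ C * smear μ (fun u ↦ exp (-(1 / (4 * (2 * t))) * u ^ 2)) y := by
      rw [abs_div, abs_two]
      linarith [abs_nonneg (smear μ (gaussKernelDeriv₂ s) y)]
    rw [norm_mul]
    calc _ ≤ C * smear μ (fun u ↦ exp (-(1 / (4 * (2 * t))) * u ^ 2)) y
          * ((L + 1) * (1 + y ^ 2)) :=
          mul_le_mul h2 (abs_log_add_one_le (hlog s hs y)) (abs_nonneg _)
            ((abs_nonneg _).trans h2)
      _ = _ := by ring
  · have hs0 : 0 < s := by linarith [hs.1]
    have hd := hasDerivAt_heatDensity_time (μ := μ) hs0 y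
    have hne := (heatDensity_pos (μ := μ) hs0 y).ne'
    refine (hd.mul (hd.log hne)).congr_deriv ?_
    field_simp

/-- De Bruijn's identity. -/
lemma hasDerivAt_smoothedEntropy_fisher (hμ : Integrable (fun x ↦ x ^ 2) μ) (ht : 0 < t)
    (hI : Integrable fun y ↦ smear μ (gaussKernelDeriv t) y ^ 2 / heatDensity μ t y) :
    HasDerivAt (smoothedEntropy μ)
      ((∫ y, smear μ (gaussKernelDeriv t) y ^ 2 / heatDensity μ t y) / 2) t := by
  refine (hasDerivAt_smoothedEntropy hμ ht).congr_deriv ?_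
  obtain ⟨C, hC, h⟩ := exists_gaussKernel_bound (a := t) (b := t) ht
  obtain ⟨L, hL, hlog⟩ := exists_abs_log_heatDensity_le (μ := μ) (a := t) (b := t) ht
  have hc : 0 < 1 / (4 * t) := by positivity
  have ht' : t ∈ Set.Icc t t := ⟨le_rfl, le_rfl⟩
  have hcont := (continuous_log_heatDensity (μ := μ) ht).add (continuous_const (y := (1 : ℝ)))
  have key := integral_mul_deriv_eq_deriv_mul_of_integrable
    (u := fun y ↦ log (heatDensity μ t y) + 1) (v := smear μ (gaussKernelDeriv t))
    (u' := fun y ↦ smear μ (gaussKernelDeriv t) y / heatDensity μ t y)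
    (v' := smear μ (gaussKernelDeriv₂ t))
    (fun y _ ↦ ((hasDerivAt_heatDensity ht y).log (heatDensity_pos ht y).ne').add_const 1)
    (fun y _ ↦ hasDerivAt_smear_gaussKernelDeriv ht y)
    (integrable_mul_of_quadratic_growth hμ hc (by positivity : 0 ≤ L + 1)
      (continuous_smear_gaussKernelDeriv₂ ht) hcont
      (abs_smear_le (fun u ↦ (h t ht' u).2.2) hc) fun y ↦ abs_log_add_one_le (hlog t ht' y))
    (hI.congr (ae_of_all _ fun y ↦ by simp only [Pi.mul_apply]; ring))
    (integrable_mul_of_quadratic_growth hμ hc (by positivity : 0 ≤ L + 1)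
      (continuous_smear_gaussKernelDeriv ht) hcont
      (abs_smear_le (fun u ↦ (h t ht' u).2.1) hc) fun y ↦ abs_log_add_one_le (hlog t ht' y))
  calc -∫ y, smear μ (gaussKernelDeriv₂ t) y / 2 * (log (heatDensity μ t y) + 1)
      = -((∫ y, (log (heatDensity μ t y) + 1) * smear μ (gaussKernelDeriv₂ t) y) / 2) := by
        rw [← integral_div]
        congr 2 with y
        ring
    _ = (∫ y, smear μ (gaussKernelDeriv t) y / heatDensity μ t y
          * smear μ (gaussKernelDeriv t) y) / 2 := by rw [key]; ring
    _ = _ := by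
        congr 2 with y
        ring

end HeatFlow

section Channel

variable {Ω : Type*} [MeasurableSpace Ω] {P : Measure Ω} [IsProbabilityMeasure P] {X Z : Ω → ℝ}
  {t : ℝ}

lemma measurable_ofReal_gaussKernel (t : ℝ) :
    Measurable fun u ↦ ENNReal.ofReal (gaussKernel t u) :=
  (continuous_gaussKernel t).measurable.ennreal_ofReal

lemma gaussianReal_map_sqrt_mul (ht : 0 < t) :
    (gaussianReal 0 1).map (fun z ↦ √t * z)
      = volume.withDensity fun u ↦ ENNReal.ofReal (gaussKernel t u) := by
  have hv : (NNReal.mk (√t ^ 2) (sq_nonneg _)) * 1 = t.toNNReal := by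
    ext
    simp [Real.sq_sqrt ht.le, ht.le]
  rw [gaussianReal_map_const_mul, mul_zero, hv, gaussianReal_of_var_ne_zero _ (by simpa using ht)]
  congr with u
  simp [gaussianPDF, gaussianPDFReal, gaussKernel, ht.le]

/-- The joint law of the input and the output of the Gaussian channel. -/
lemma map_input_output (hX : Measurable X) (hZ : Measurable Z)
    (hindep : IndepFun X Z P) (hZlaw : P.map Z = gaussianReal 0 1) (ht : 0 < t) :
    P.map (fun ω ↦ (X ω, X ω + √t * Z ω))
      = ((P.map X).prod volume).withDensity
        fun p ↦ ENNReal.ofReal (gaussKernel t (p.2 - p.1)) := by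
  have := Measure.isProbabilityMeasure_map (μ := P) hX.aemeasurable
  have hm := measurePreserving_prod_add (P.map X) (volume : Measure ℝ)
  have hXV : P.map (fun ω ↦ (X ω, √t * Z ω))
      = ((P.map X).prod volume).withDensity fun p ↦ ENNReal.ofReal (gaussKernel t p.2) := by
    have h := (indepFun_iff_map_prod_eq_prod_map_map hX.aemeasurable
      (hZ.const_mul (√t)).aemeasurable).1 (hindep.comp measurable_id (measurable_const_mul (√t)))
    have hV : P.map (fun ω ↦ √t * Z ω)
        = volume.withDensity fun u ↦ ENNReal.ofReal (gaussKernel t u) := by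
      rw [← gaussianReal_map_sqrt_mul ht, ← hZlaw, Measure.map_map (by fun_prop) hZ]
      rfl
    rw [← prod_withDensity_right (measurable_ofReal_gaussKernel t), ← hV]
    exact h
  have hcomp : (fun ω ↦ (X ω, X ω + √t * Z ω))
      = (fun z : ℝ × ℝ ↦ (z.1, z.1 + z.2)) ∘ fun ω ↦ (X ω, √t * Z ω) := rfl
  rw [hcomp, ← Measure.map_map (by fun_prop) (by fun_prop), hXV]
  ext s hs
  have hk : Measurable fun p : ℝ × ℝ ↦ ENNReal.ofReal (gaussKernel t (p.2 - p.1)) :=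
    (measurable_ofReal_gaussKernel t).comp (by fun_prop)
  rw [Measure.map_apply hm.measurable hs, withDensity_apply _ (hm.measurable hs),
    withDensity_apply _ hs, ← hm.setLIntegral_comp_preimage hs hk]
  simp

/-- The output of the Gaussian channel has density `heatDensity`. -/
lemma map_output (hX : Measurable X) (hZ : Measurable Z)
    (hindep : IndepFun X Z P) (hZlaw : P.map Z = gaussianReal 0 1) (ht : 0 < t) :
    P.map (fun ω ↦ X ω + √t * Z ω)
      = volume.withDensity fun y ↦ ENNReal.ofReal (heatDensity (P.map X) t y) := by
  have := Measure.isProbabilityMeasure_map (μ := P) hX.aemeasurable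
  have hcomp : (fun ω ↦ X ω + √t * Z ω) = Prod.snd ∘ fun ω ↦ (X ω, X ω + √t * Z ω) := rfl
  have hk : Measurable fun p : ℝ × ℝ ↦ ENNReal.ofReal (gaussKernel t (p.2 - p.1)) :=
    (measurable_ofReal_gaussKernel t).comp (by fun_prop)
  rw [hcomp, ← Measure.map_map (by fun_prop) (by fun_prop),
    map_input_output hX hZ hindep hZlaw ht]
  ext s hs
  have hpre : (Prod.snd ⁻¹' s : Set (ℝ × ℝ)) = Set.univ ×ˢ s := by ext; simp
  rw [Measure.map_apply measurable_snd hs, withDensity_apply _ (measurable_snd hs),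
    withDensity_apply _ hs, hpre, ← Measure.prod_restrict, Measure.restrict_univ,
    lintegral_prod_symm _ hk.aemeasurable]
  refine lintegral_congr fun y ↦ ?_
  rw [heatDensity_eq_smear, smear, ofReal_integral_eq_lintegral_ofReal
    (integrable_gaussKernel_comp_sub ht y) (ae_of_all _ fun x ↦ (gaussKernel_pos ht _).le)]

lemma integrable_comp_output_iff (hX : Measurable X) (hZ : Measurable Z)
    (hindep : IndepFun X Z P) (hZlaw : P.map Z = gaussianReal 0 1) (ht : 0 < t) {g : ℝ → ℝ}
    (hg : Measurable g) :
    Integrable (fun ω ↦ g (X ω + √t * Z ω)) P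
      ↔ Integrable fun y ↦ heatDensity (P.map X) t y * g y := by
  have := Measure.isProbabilityMeasure_map (μ := P) hX.aemeasurable
  have h := integrable_map_measure (μ := P) (f := fun ω ↦ X ω + √t * Z ω) (g := g)
    hg.aestronglyMeasurable (by fun_prop)
  rw [map_output hX hZ hindep hZlaw ht, integrable_withDensity_iff_integrable_smul'
    (continuous_heatDensity ht).measurable.ennreal_ofReal (by simp)] at h
  simpa [Function.comp_def, (heatDensity_pos ht _).le] using h.symm

lemma integral_comp_output (hX : Measurable X) (hZ : Measurable Z)
    (hindep : IndepFun X Z P) (hZlaw : P.map Z = gaussianReal 0 1) (ht : 0 < t) {g : ℝ → ℝ}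
    (hg : Measurable g) :
    ∫ ω, g (X ω + √t * Z ω) ∂P = ∫ y, heatDensity (P.map X) t y * g y := by
  have := Measure.isProbabilityMeasure_map (μ := P) hX.aemeasurable
  have h := integral_map (μ := P) (φ := fun ω ↦ X ω + √t * Z ω) (f := g)
    (by fun_prop) hg.aestronglyMeasurable
  rw [map_output hX hZ hindep hZlaw ht, integral_withDensity_eq_integral_toReal_smul
    (continuous_heatDensity ht).measurable.ennreal_ofReal (by simp)] at h
  simpa [(heatDensity_pos ht _).le] using h.symm

/-- Tweedie's formula: the conditional mean of the noise is given by the score of the output. -/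
lemma condExp_noise (hX : Measurable X) (hZ : Measurable Z)
    (hindep : IndepFun X Z P) (hZlaw : P.map Z = gaussianReal 0 1)
    (hX2 : Integrable (fun ω ↦ X ω ^ 2) P) (ht : 0 < t) :
    P[fun ω ↦ -(√t * Z ω) | MeasurableSpace.comap (fun ω ↦ X ω + √t * Z ω) inferInstance]
      =ᵐ[P] fun ω ↦ t * (smear (P.map X) (gaussKernelDeriv t) (X ω + √t * Z ω)
        / heatDensity (P.map X) t (X ω + √t * Z ω)) := by
  have := Measure.isProbabilityMeasure_map (μ := P) hX.aemeasurable
  have hμ : Integrable (fun x ↦ x ^ 2) (P.map X) :=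
    (integrable_map_measure (by fun_prop) hX.aemeasurable).2 hX2
  set μ := P.map X
  have hY : Measurable fun ω ↦ X ω + √t * Z ω := by fun_prop
  have hZint : Integrable Z P := by
    have : Integrable id (P.map Z) := hZlaw ▸ (memLp_id_gaussianReal 1).integrable le_rfl
    exact (integrable_map_measure (by fun_prop) hZ.aemeasurable).1 this
  have hscore : Measurable fun y ↦ t * (smear μ (gaussKernelDeriv t) y / heatDensity μ t y) :=
    ((continuous_smear_gaussKernelDeriv ht).measurable.div
      (continuous_heatDensity ht).measurable).const_mul t
  have hcancel : ∀ y, heatDensity μ t y * (t * (smear μ (gaussKernelDeriv t) y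
      / heatDensity μ t y)) = t * smear μ (gaussKernelDeriv t) y := fun y ↦ by
    have := (heatDensity_pos (μ := μ) ht y).ne'
    field_simp
  have hderiv : Integrable (smear μ (gaussKernelDeriv t)) := by
    obtain ⟨C, hC, h⟩ := exists_gaussKernel_bound (a := t) (b := t) ht
    have := integrable_mul_of_quadratic_growth hμ (by positivity : 0 < 1 / (4 * t)) zero_le_one
      (continuous_smear_gaussKernelDeriv ht) (continuous_const (y := (1 : ℝ)))
      (abs_smear_le (fun u ↦ (h t ⟨le_rfl, le_rfl⟩ u).2.1) (by positivity))
      (fun y ↦ by rw [abs_one]; nlinarith [sq_nonneg y])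
    exact this.congr (ae_of_all _ fun y ↦ one_mul _)
  have hscore_int : Integrable (fun ω ↦ t * (smear μ (gaussKernelDeriv t) (X ω + √t * Z ω)
      / heatDensity μ t (X ω + √t * Z ω))) P := by
    refine (integrable_comp_output_iff hX hZ hindep hZlaw ht hscore).2 ?_
    exact (hderiv.const_mul t).congr (ae_of_all _ fun y ↦ (hcancel y).symm)
  refine (ae_eq_condExp_of_forall_setIntegral_eq hY.comap_le (hZint.const_mul _).neg
    (fun s _ _ ↦ hscore_int.integrableOn) ?_ ?_).symm
  swap
  · exact (hscore.comp (comap_measurable _)).aestronglyMeasurable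
  rintro _ ⟨B, hB, rfl⟩ -
  have hk : Measurable fun p : ℝ × ℝ ↦ ENNReal.ofReal (gaussKernel t (p.2 - p.1)) :=
    (measurable_ofReal_gaussKernel t).comp (by fun_prop)
  have hψ : Measurable fun p : ℝ × ℝ ↦ B.indicator (fun _ ↦ (1 : ℝ)) p.2 * (p.1 - p.2) :=
    ((measurable_const.indicator hB).comp measurable_snd).mul (by fun_prop)
  have hprod : ∀ p : ℝ × ℝ, (ENNReal.ofReal (gaussKernel t (p.2 - p.1))).toReal •
      (B.indicator (fun _ ↦ (1 : ℝ)) p.2 * (p.1 - p.2))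
      = t * (B.indicator (fun _ ↦ (1 : ℝ)) p.2 * gaussKernelDeriv t (p.2 - p.1)) := fun p ↦ by
    rw [ENNReal.toReal_ofReal (gaussKernel_pos ht _).le, smul_eq_mul, gaussKernelDeriv]
    field_simp
    ring
  have hrhs : ∀ ω, (((fun ω ↦ X ω + √t * Z ω) ⁻¹' B).indicator (fun ω ↦ -(√t * Z ω)) ω)
      = B.indicator (fun _ ↦ (1 : ℝ)) (X ω + √t * Z ω) * (X ω - (X ω + √t * Z ω)) := fun ω ↦ by
    by_cases h : X ω + √t * Z ω ∈ B <;> simp [Set.indicator, h]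
  have hlhs : ∀ y, B.indicator (fun y ↦ t * (smear μ (gaussKernelDeriv t) y
      / heatDensity μ t y)) y = B.indicator (fun _ ↦ (1 : ℝ)) y * (t *
        (smear μ (gaussKernelDeriv t) y / heatDensity μ t y)) := fun y ↦ by
    by_cases h : y ∈ B <;> simp [Set.indicator, h]
  have hjoint_int : Integrable (fun p : ℝ × ℝ ↦
      t * (B.indicator (fun _ ↦ (1 : ℝ)) p.2 * gaussKernelDeriv t (p.2 - p.1)))
      (μ.prod volume) := by
    have h0 : Integrable (fun ω ↦ B.indicator (fun _ ↦ (1 : ℝ)) (X ω + √t * Z ω)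
        * (X ω - (X ω + √t * Z ω))) P := by
      simp_rw [← hrhs]
      exact (hZint.const_mul _).neg.indicator (hY hB)
    have h1 := (integrable_map_measure (μ := P) (f := fun ω ↦ (X ω, X ω + √t * Z ω))
      hψ.aestronglyMeasurable (by fun_prop)).2 h0
    rw [map_input_output hX hZ hindep hZlaw ht,
      integrable_withDensity_iff_integrable_smul' hk (by simp)] at h1
    simpa only [hprod] using h1
  calc ∫ ω in (fun ω ↦ X ω + √t * Z ω) ⁻¹' B, t * (smear μ (gaussKernelDeriv t) (X ω + √t * Z ω)
        / heatDensity μ t (X ω + √t * Z ω)) ∂P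
      = ∫ ω, B.indicator (fun y ↦ t * (smear μ (gaussKernelDeriv t) y
          / heatDensity μ t y)) (X ω + √t * Z ω) ∂P := by
        rw [← integral_indicator (hY hB)]
        rfl
    _ = ∫ y, t * (B.indicator (fun _ ↦ (1 : ℝ)) y * smear μ (gaussKernelDeriv t) y) := by
        rw [integral_comp_output hX hZ hindep hZlaw ht (hscore.indicator hB)]
        refine integral_congr_ae (ae_of_all _ fun y ↦ ?_)
        beta_reduce
        rw [hlhs, mul_left_comm, hcancel]
        ring
    _ = ∫ p : ℝ × ℝ, t * (B.indicator (fun _ ↦ (1 : ℝ)) p.2 * gaussKernelDeriv t (p.2 - p.1))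
          ∂(μ.prod volume) := by
        rw [integral_prod_symm _ hjoint_int]
        refine integral_congr_ae (ae_of_all _ fun y ↦ ?_)
        simp only [smear, integral_const_mul]
    _ = ∫ ω, B.indicator (fun _ ↦ (1 : ℝ)) (X ω + √t * Z ω) * (X ω - (X ω + √t * Z ω)) ∂P := by
        rw [← integral_map (μ := P) (φ := fun ω ↦ (X ω, X ω + √t * Z ω))
          (f := fun p : ℝ × ℝ ↦ B.indicator (fun _ ↦ (1 : ℝ)) p.2 * (p.1 - p.2)) (by fun_prop)
          hψ.aestronglyMeasurable, map_input_output hX hZ hindep hZlaw ht,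
          integral_withDensity_eq_integral_toReal_smul hk (by simp)]
        simp only [hprod]
        rfl
    _ = _ := by
        rw [← integral_indicator (hY hB)]
        exact integral_congr_ae (ae_of_all _ fun ω ↦ (hrhs ω).symm)

end Channel

/-- Second moment of the conditional mean of the noise, in terms of that of the input. -/
lemma integral_sq_condExp_noise {Ω : Type*} [MeasurableSpace Ω] {P : Measure Ω}
    [IsProbabilityMeasure P] {X Z : Ω → ℝ} (hX : Measurable X) (hZ : Measurable Z)
    (hindep : IndepFun X Z P) (hZlaw : P.map Z = gaussianReal 0 1)
    (hX2 : Integrable (fun ω ↦ X ω ^ 2) P) {t : ℝ} (ht : 0 < t) :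
    Integrable (fun ω ↦ (P[fun ω ↦ -(√t * Z ω) | MeasurableSpace.comap
      (fun ω ↦ X ω + √t * Z ω) inferInstance]) ω ^ 2) P ∧
    ∫ ω, (P[fun ω ↦ -(√t * Z ω) | MeasurableSpace.comap
      (fun ω ↦ X ω + √t * Z ω) inferInstance]) ω ^ 2 ∂P
      = ∫ ω, (P[X | MeasurableSpace.comap (fun ω ↦ X ω + √t * Z ω) inferInstance]) ω ^ 2 ∂P
        - ∫ ω, X ω ^ 2 ∂P + t := by
  have hY : Measurable fun ω ↦ X ω + √t * Z ω := by fun_prop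
  have hm := hY.comap_le
  have hXL : MemLp X 2 P := (memLp_two_iff_integrable_sq hX.aestronglyMeasurable).2 hX2
  have hZL : MemLp Z 2 P := by
    have h : MemLp id 2 (P.map Z) := hZlaw ▸ memLp_id_gaussianReal 2
    exact (memLp_map_measure_iff aestronglyMeasurable_id hZ.aemeasurable).1 h
  set Y : Ω → ℝ := fun ω ↦ X ω + √t * Z ω
  set N : Ω → ℝ := fun ω ↦ -(√t * Z ω)
  set m : MeasurableSpace Ω := MeasurableSpace.comap Y inferInstance
  have hNL : MemLp N 2 P := (hZL.const_mul (√t)).neg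
  have hYL : MemLp Y 2 P := hXL.add (hZL.const_mul (√t))
  have hSL : MemLp (P[N | m]) 2 P := hNL.condExp one_le_two
  have hYm : StronglyMeasurable[m] Y := (comap_measurable Y).stronglyMeasurable
  refine ⟨hSL.integrable_sq, ?_⟩
  have hZ1 : ∫ ω, Z ω ∂P = 0 := by
    rw [← integral_map (φ := Z) (f := fun z ↦ z) hZ.aemeasurable (by fun_prop), hZlaw,
      integral_id_gaussianReal]
  have hZ2 : ∫ ω, Z ω ^ 2 ∂P = 1 := by
    have h := variance_of_integral_eq_zero (μ := gaussianReal 0 1) (X := id) (by fun_prop)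
      integral_id_gaussianReal
    rw [variance_id_gaussianReal] at h
    rw [← integral_map (φ := Z) (f := fun z ↦ z ^ 2) hZ.aemeasurable (by fun_prop), hZlaw]
    simpa using h.symm
  have hXZ : ∫ ω, X ω * Z ω ∂P = 0 := by
    rw [hindep.integral_fun_mul_eq_mul_integral hX.aestronglyMeasurable hZ.aestronglyMeasurable,
      hZ1, mul_zero]
  have hXZi : Integrable (fun ω ↦ X ω * Z ω) P := hXL.integrable_mul hZL
  have hZi : Integrable (fun ω ↦ Z ω ^ 2) P := hZL.integrable_sq
  have ht2 : √t ^ 2 = t := Real.sq_sqrt ht.le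
  have hYsq : ∫ ω, Y ω ^ 2 ∂P = ∫ ω, X ω ^ 2 ∂P + t := by
    have : ∀ ω, Y ω ^ 2 = X ω ^ 2 + 2 * √t * (X ω * Z ω) + t * Z ω ^ 2 := fun ω ↦ by
      rw [← ht2, Real.sqrt_sq (by positivity)]; ring
    simp_rw [this]
    rw [integral_add (hX2.fun_add (hXZi.const_mul _)) (hZi.const_mul _),
      integral_add hX2 (hXZi.const_mul _), integral_const_mul, integral_const_mul, hXZ, hZ2]
    ring
  have hYN : ∫ ω, Y ω * N ω ∂P = -t := by
    have : ∀ ω, Y ω * N ω = -√t * (X ω * Z ω) + -t * Z ω ^ 2 := fun ω ↦ by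
      rw [← ht2, Real.sqrt_sq (by positivity)]; ring
    simp_rw [this]
    rw [integral_add (hXZi.const_mul _) (hZi.const_mul _), integral_const_mul,
      integral_const_mul, hXZ, hZ2]
    ring
  have hYS : ∫ ω, Y ω * (P[N | m]) ω ∂P = -t := by
    rw [← hYN, ← integral_condExp hm (f := fun ω ↦ Y ω * N ω)]
    exact integral_congr_ae (condExp_mul_of_stronglyMeasurable_left hYm
      (hYL.integrable_mul hNL) (hNL.integrable one_le_two)).symm
  have hdecomp : P[X | m] =ᵐ[P] Y + P[N | m] := by
    have hXYN : X = Y + N := by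
      ext ω
      simp [Y, N]
    have h := condExp_add (hYL.integrable one_le_two) (hNL.integrable one_le_two) m
    rw [← hXYN, condExp_of_stronglyMeasurable hm hYm (hYL.integrable one_le_two)] at h
    exact h
  have hW : ∫ ω, (P[X | m]) ω ^ 2 ∂P
      = ∫ ω, Y ω ^ 2 ∂P + 2 * ∫ ω, Y ω * (P[N | m]) ω ∂P + ∫ ω, (P[N | m]) ω ^ 2 ∂P := by
    have h : Integrable (fun ω ↦ Y ω * (P[N | m]) ω) P := hYL.integrable_mul hSL
    rw [← integral_const_mul, ← integral_add hYL.integrable_sq (h.const_mul 2),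
      ← integral_add (hYL.integrable_sq.fun_add (h.const_mul 2)) hSL.integrable_sq]
    refine integral_congr_ae (hdecomp.mono fun ω hω ↦ ?_)
    simp only [hω, Pi.add_apply]
    ring
  rw [hW, hYsq, hYS]
  ring

/-- Derivative of the entropy of `Y = X + √t·Z` in `t`: if `X` has finite variance,
`t > 0`, and `Z ~ N(0,1)` is independent of `X`, then
`d/dt H(X + √t·Z) = (−E[X²] + E[(E[X|Y])²])/(2t²) + 1/(2t)`. -/
theorem entropy_deriv_of_gaussian_smoothing {Ω : Type*} [MeasurableSpace Ω] (P : Measure Ω)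
    [IsProbabilityMeasure P] (X Z : Ω → ℝ) (hX : Measurable X) (hZ : Measurable Z)
    (hindep : IndepFun X Z P) (hZlaw : P.map Z = gaussianReal 0 1)
    (hX2 : Integrable (fun ω => (X ω) ^ 2) P)
    (t : ℝ) (ht : 0 < t) :
    HasDerivAt (fun s : ℝ => smoothedEntropy (P.map X) s)
      ((-(∫ ω, (X ω) ^ 2 ∂P) +
          ∫ ω, ((P[X | MeasurableSpace.comap (fun ω => X ω + Real.sqrt t * Z ω)
            inferInstance]) ω) ^ 2 ∂P) / (2 * t ^ 2) + 1 / (2 * t)) t := by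
  have := Measure.isProbabilityMeasure_map (μ := P) hX.aemeasurable
  have hμ : Integrable (fun x ↦ x ^ 2) (P.map X) :=
    (integrable_map_measure (by fun_prop) hX.aemeasurable).2 hX2
  obtain ⟨hint, hval⟩ := integral_sq_condExp_noise hX hZ hindep hZlaw hX2 ht
  have htweedie := condExp_noise hX hZ hindep hZlaw hX2 ht
  set μ := P.map X
  have hmeas : Measurable fun y ↦ (t * (smear μ (gaussKernelDeriv t) y / heatDensity μ t y)) ^ 2 :=
    (((continuous_smear_gaussKernelDeriv ht).measurable.div
      (continuous_heatDensity ht).measurable).const_mul t).pow_const 2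
  have hfisher : ∀ y, heatDensity μ t y
      * (t * (smear μ (gaussKernelDeriv t) y / heatDensity μ t y)) ^ 2
      = t ^ 2 * (smear μ (gaussKernelDeriv t) y ^ 2 / heatDensity μ t y) := fun y ↦ by
    have := (heatDensity_pos (μ := μ) ht y).ne'
    field_simp
  have hsq := htweedie.mono fun ω hω ↦ congrArg (· ^ 2) hω
  have hI : Integrable fun y ↦ smear μ (gaussKernelDeriv t) y ^ 2 / heatDensity μ t y := by
    have h := (integrable_comp_output_iff hX hZ hindep hZlaw ht hmeas).1 (hint.congr hsq)
    exact (integrable_const_mul_iff (pow_pos ht 2).ne'.isUnit _).1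
      (h.congr (ae_of_all _ hfisher))
  have hE := integral_congr_ae hsq
  rw [hval, integral_comp_output hX hZ hindep hZlaw ht hmeas,
    integral_congr_ae (ae_of_all _ hfisher), integral_const_mul] at hE
  refine (hasDerivAt_smoothedEntropy_fisher hμ ht hI).congr_deriv ?_
  rw [(eq_div_iff (pow_pos ht 2).ne').2 ((mul_comm _ _).trans hE.symm)]
  field_simp
  ring
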